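/- Let g : ℝⁿ → Matrix (Fin n) (Fin n) ℝ be C^∞ with g(x) symmetric and positive definite for every x, let φ : ℝⁿ → ℝ be C^∞, let F : ℝ × ℝⁿ → ℝⁿ be C^∞ with F(0,·) = id and with f_t := F(t,·) a diffeomorphism of ℝⁿ for each t, and let V(x) denote the t-derivative of t ↦ F(t,x) at t = 0. Then for every x the function t ↦ Δ_{f_t*g}φ(x) is differentiable at t = 0 with derivative (fderiv ℝ (Δ_g φ) x)(V(x)) − Δ_g( y ↦ (fderiv ℝ φ y)(V(y)) )(x). That is, the first-order deformation of the Laplace–Beltrami operator along the diffeomorphism orbit of g is the commutator [L_V, Δ_g], where L_V is the Lie derivative (directional derivative) along V: Δ_{g + εL_V g} = Δ_g + ε[L_V, Δ_g] modulo ε². -/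

import Mathlib

open Matrix

/-- The `μ`-th coordinate partial derivative `∂_μ ψ (x) = fderiv ℝ ψ x (e_μ)`. -/
noncomputable def pd (n : ℕ) (μ : Fin n) (ψ : (Fin n → ℝ) → ℝ) (x : Fin n → ℝ) : ℝ :=
  fderiv ℝ ψ x (Pi.single μ 1)

/-- The coordinate Laplace–Beltrami operator
`Δ_g φ (x) = (det g x)^(-1/2) ∑_μ ∂_μ ( y ↦ (det g y)^(1/2) ∑_ν (g y)⁻¹ μ ν ∂_ν φ y ) x`. -/
noncomputable def lapBel (n : ℕ) (g : (Fin n → ℝ) → Matrix (Fin n) (Fin n) ℝ)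
    (φ : (Fin n → ℝ) → ℝ) (x : Fin n → ℝ) : ℝ :=
  (Real.sqrt (g x).det)⁻¹ *
    ∑ μ, pd n μ (fun y => Real.sqrt (g y).det * ∑ ν, (g y)⁻¹ μ ν * pd n ν φ y) x

/-- The Jacobian matrix of `f` at `x`: the matrix of `fderiv ℝ f x` in the standard basis. -/
noncomputable def jacobian (n : ℕ) (f : (Fin n → ℝ) → (Fin n → ℝ)) (x : Fin n → ℝ) :
    Matrix (Fin n) (Fin n) ℝ :=
  Matrix.of fun i j => fderiv ℝ f x (Pi.single j 1) i

/-- The pullback metric `(f*g)(x) = (Df x)ᵀ * g (f x) * Df x`. -/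
noncomputable def pullbackMet (n : ℕ) (f : (Fin n → ℝ) → (Fin n → ℝ))
    (g : (Fin n → ℝ) → Matrix (Fin n) (Fin n) ℝ) (x : Fin n → ℝ) :
    Matrix (Fin n) (Fin n) ℝ :=
  (jacobian n f x)ᵀ * g (f x) * jacobian n f x

section Helpers

variable {n : ℕ}

theorem two_le_inf : (2 : WithTop ℕ∞) ≤ ((⊤ : ℕ∞) : WithTop ℕ∞) := by
  change (((2 : ℕ∞)) : WithTop ℕ∞) ≤ _
  exact WithTop.coe_le_coe.2 le_top

theorem pd_mul {μ : Fin n} {a b : (Fin n → ℝ) → ℝ} {x : Fin n → ℝ}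
    (ha : DifferentiableAt ℝ a x) (hb : DifferentiableAt ℝ b x) :
    pd n μ (fun y => a y * b y) x = pd n μ a x * b x + a x * pd n μ b x := by
  unfold pd
  rw [fderiv_fun_mul ha hb]
  simp; ring

theorem pd_sum {ι : Type*} [Fintype ι] {μ : Fin n} {a : ι → (Fin n → ℝ) → ℝ} {x : Fin n → ℝ}
    (ha : ∀ i, DifferentiableAt ℝ (a i) x) :
    pd n μ (fun y => ∑ i, a i y) x = ∑ i, pd n μ (a i) x := by
  unfold pd
  rw [fderiv_fun_sum (fun i _ => ha i)]
  simp

theorem pd_congr {μ : Fin n} {a b : (Fin n → ℝ) → ℝ} {x : Fin n → ℝ}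
    (h : a =ᶠ[nhds x] b) : pd n μ a x = pd n μ b x := by
  unfold pd; rw [h.fderiv_eq]

theorem vec_eq_sum (v : Fin n → ℝ) : v = ∑ k, v k • (Pi.single k (1 : ℝ) : Fin n → ℝ) := by
  ext i
  simp [Finset.sum_apply, Pi.single_apply]

theorem pd_comp {μ : Fin n} {w : (Fin n → ℝ) → ℝ} {f : (Fin n → ℝ) → (Fin n → ℝ)} {x : Fin n → ℝ}
    (hw : DifferentiableAt ℝ w (f x)) (hf : DifferentiableAt ℝ f x) :
    pd n μ (fun y => w (f y)) x = ∑ k, pd n k w (f x) * jacobian n f x k μ := by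
  unfold pd jacobian
  have : fderiv ℝ (fun y => w (f y)) x = (fderiv ℝ w (f x)).comp (fderiv ℝ f x) :=
    fderiv_comp x hw hf
  rw [this, ContinuousLinearMap.comp_apply]
  conv_lhs => rw [vec_eq_sum (fderiv ℝ f x (Pi.single μ 1))]
  simp [map_sum, mul_comm]

theorem jac_eq_pd {f : (Fin n → ℝ) → (Fin n → ℝ)} {x : Fin n → ℝ}
    (hf : DifferentiableAt ℝ f x) (i j : Fin n) :
    jacobian n f x i j = pd n j (fun y => f y i) x := by
  unfold pd jacobian
  rw [fderiv_pi (fun i => by fun_prop)]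
  simp [fderiv_apply hf]

theorem pd_pd_symm {u : (Fin n → ℝ) → ℝ} (hu : ContDiff ℝ (⊤ : ℕ∞) u) (i j : Fin n)
    (x : Fin n → ℝ) : pd n i (fun y => pd n j u y) x = pd n j (fun y => pd n i u y) x := by
  have h1 : DifferentiableAt ℝ (fderiv ℝ u) x :=
    (hu.fderiv_right (m := (⊤ : ℕ∞)) (by simp)).differentiable (by simp) x
  have hs : IsSymmSndFDerivAt ℝ u x :=
    hu.contDiffAt.isSymmSndFDerivAt (by simpa using two_le_inf)
  unfold pd
  have key : ∀ v w : Fin n → ℝ, fderiv ℝ (fun y => fderiv ℝ u y v) x w =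
      fderiv ℝ (fderiv ℝ u) x w v := by
    intro v w
    rw [fderiv_clm_apply h1 (by fun_prop)]
    simp
  rw [key, key]
  exact hs _ _

theorem contDiff_det {E : Type*} [NormedAddCommGroup E] [NormedSpace ℝ E] {k : ℕ∞}
    {M : E → Matrix (Fin n) (Fin n) ℝ} (hM : ∀ i j, ContDiff ℝ k fun x => M x i j) :
    ContDiff ℝ k fun x => (M x).det := by
  simp only [Matrix.det_apply]
  refine ContDiff.sum fun σ _ => ContDiff.const_smul _ ?_
  exact contDiff_prod fun i _ => hM _ _

theorem contDiff_inv {E : Type*} [NormedAddCommGroup E] [NormedSpace ℝ E] {k : ℕ∞}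
    {M : E → Matrix (Fin n) (Fin n) ℝ} (hM : ∀ i j, ContDiff ℝ k fun x => M x i j)
    (h0 : ∀ x, (M x).det ≠ 0) (i j : Fin n) :
    ContDiff ℝ k fun x => (M x)⁻¹ i j := by
  have : (fun x => (M x)⁻¹ i j) = fun x => ((M x).det)⁻¹ * ((M x).updateRow j (Pi.single i 1)).det := by
    ext x
    rw [Matrix.inv_def]
    simp [Matrix.adjugate_apply]
  rw [this]
  refine ((contDiff_det hM).inv h0).mul (contDiff_det fun a b => ?_)
  simp only [Matrix.updateRow_apply]
  split_ifs
  · fun_prop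
  · exact hM _ _

theorem pd_det {M : (Fin n → ℝ) → Matrix (Fin n) (Fin n) ℝ} {x : Fin n → ℝ} (μ : Fin n)
    (hM : ∀ i j, DifferentiableAt ℝ (fun x => M x i j) x) :
    pd n μ (fun y => (M y).det) x =
      ∑ i, ∑ j, pd n μ (fun y => M y i j) x * (M x).adjugate j i := by
  let D : ContinuousMultilinearMap ℝ (fun _ : Fin n => (Fin n → ℝ)) ℝ :=
    { toMultilinearMap := (Matrix.detRowAlternating (n := Fin n) (R := ℝ)).toMultilinearMap
      cont := by
        exact Continuous.matrix_det (A := fun m : Fin n → Fin n → ℝ => (Matrix.of m)) continuous_id }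
  have hrow : ∀ i, DifferentiableAt ℝ (fun y => M y i) x := fun i =>
    differentiableAt_pi.2 fun j => hM i j
  have h := HasFDerivAt.multilinear_comp D (g := fun i y => M y i)
    (fun i => (hrow i).hasFDerivAt)
  have h' : HasFDerivAt (fun y => (M y).det) _ x := h
  unfold pd
  rw [h'.fderiv]
  simp only [_root_.sum_apply, ContinuousLinearMap.comp_apply]
  refine Finset.sum_congr rfl fun i _ => ?_
  change ((M x).updateRow i (fderiv ℝ (fun y => M y i) x (Pi.single μ 1))).det = _
  rw [← Matrix.cramer_transpose_apply, Matrix.cramer_eq_adjugate_mulVec,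
    ← Matrix.adjugate_transpose]
  simp only [Matrix.mulVec, dotProduct, Matrix.transpose_apply]
  refine Finset.sum_congr rfl fun j _ => ?_
  rw [fderiv_pi (fun j => hM i j)]
  simp [mul_comm]

theorem contDiff_jac {f : (Fin n → ℝ) → (Fin n → ℝ)} (hf : ContDiff ℝ (⊤ : ℕ∞) f) (i j : Fin n) :
    ContDiff ℝ (⊤ : ℕ∞) fun y => jacobian n f y i j := by
  have h1 : ContDiff ℝ (⊤ : ℕ∞) (fderiv ℝ f) := hf.fderiv_right (by simp)
  have h2 : ContDiff ℝ (⊤ : ℕ∞) (fun y => fderiv ℝ f y (Pi.single j 1)) :=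
    h1.clm_apply contDiff_const
  exact (contDiff_pi.1 h2) i

theorem contDiff_pd {f : (Fin n → ℝ) → ℝ} (hf : ContDiff ℝ (⊤ : ℕ∞) f) (j : Fin n) :
    ContDiff ℝ (⊤ : ℕ∞) fun y => pd n j f y := by
  have h1 : ContDiff ℝ (⊤ : ℕ∞) (fderiv ℝ f) := hf.fderiv_right (by simp)
  exact h1.clm_apply contDiff_const

theorem cd_diff {E F : Type*} [NormedAddCommGroup E] [NormedSpace ℝ E]
    [NormedAddCommGroup F] [NormedSpace ℝ F] {f : E → F} (hf : ContDiff ℝ (⊤ : ℕ∞) f) (x : E) :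
    DifferentiableAt ℝ f x := hf.differentiable (by simp) x

/-- Piola identity -/
theorem piola {f : (Fin n → ℝ) → (Fin n → ℝ)} (hf : ContDiff ℝ (⊤ : ℕ∞) f)
    (h0 : ∀ x, (jacobian n f x).det ≠ 0) (x : Fin n → ℝ) (i : Fin n) :
    ∑ μ, pd n μ (fun y => (jacobian n f y).det * (jacobian n f y)⁻¹ μ i) x = 0 := by
  have hJ := contDiff_jac hf
  have hA := contDiff_inv hJ h0
  have hd := contDiff_det hJ
  set S : Fin n → Fin n → Fin n → ℝ := fun μ b a => pd n μ (fun y => jacobian n f y b a) x with hS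
  have hsym : ∀ μ b a, S μ b a = S a b μ := by
    intro μ b a
    simp only [hS]
    have e : ∀ a, (fun y => jacobian n f y b a) = fun y => pd n a (fun z => f z b) y := by
      intro a; ext y; exact jac_eq_pd (cd_diff hf y) b a
    rw [e, e]
    exact pd_pd_symm (contDiff_pi.1 hf b) _ _ _
  set A := (jacobian n f x)⁻¹ with hAdef
  set d := (jacobian n f x).det with hddef
  have hadj : (jacobian n f x).adjugate = d • A := by
    rw [hAdef, Matrix.inv_def, smul_smul]; simp [hddef, h0 x]
  have h1 : ∀ μ, pd n μ (fun y => (jacobian n f y).det) x = d * ∑ b, ∑ a, S μ b a * A a b := by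
    intro μ
    rw [pd_det μ (fun i j => cd_diff (hJ i j) x), hadj, Finset.mul_sum]
    refine Finset.sum_congr rfl fun b _ => ?_
    rw [Finset.mul_sum]
    refine Finset.sum_congr rfl fun a _ => ?_
    simp [hS]; ring
  have h2 : ∀ μ, (Matrix.of fun a b => pd n μ (fun y => (jacobian n f y)⁻¹ a b) x)
      = -(A * (Matrix.of (S μ)) * A) := by
    intro μ
    set B := (Matrix.of fun a b => pd n μ (fun y => (jacobian n f y)⁻¹ a b) x)
    have hJA : jacobian n f x * B + Matrix.of (S μ) * A = 0 := by
      ext a b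
      have : (fun y => ∑ k, jacobian n f y a k * (jacobian n f y)⁻¹ k b) =
          fun _ => (1 : Matrix (Fin n) (Fin n) ℝ) a b := by
        ext y
        rw [← Matrix.mul_apply, Matrix.mul_nonsing_inv _ (h0 y).isUnit]
      have h3 : pd n μ (fun y => ∑ k, jacobian n f y a k * (jacobian n f y)⁻¹ k b) x =
          pd n μ (fun _ => (1 : Matrix (Fin n) (Fin n) ℝ) a b) x := by rw [this]
      rw [pd_sum (a := fun k y => jacobian n f y a k * (jacobian n f y)⁻¹ k b)
        (fun k => (cd_diff (hJ a k) x).mul (cd_diff (hA k b) x))] at h3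
      simp only [pd_mul (cd_diff (hJ a _) x) (cd_diff (hA _ b) x)] at h3
      rw [Finset.sum_add_distrib] at h3
      have h4 : pd n μ (fun _ => (1 : Matrix (Fin n) (Fin n) ℝ) a b) x = 0 := by
        simp [pd]
      rw [h4] at h3
      rw [Matrix.add_apply, Matrix.mul_apply, Matrix.mul_apply, Matrix.zero_apply, add_comm]
      exact h3
    have hAJ : A * jacobian n f x = 1 := Matrix.nonsing_inv_mul _ (h0 x).isUnit
    calc B = A * jacobian n f x * B := by rw [hAJ, one_mul]
      _ = A * (jacobian n f x * B + Matrix.of (S μ) * A) - A * (Matrix.of (S μ)) * A := by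
        noncomm_ring
      _ = _ := by rw [hJA]; simp
  have h2' : ∀ μ, pd n μ (fun y => (jacobian n f y)⁻¹ μ i) x =
      - ∑ c, ∑ b, A μ b * S μ b c * A c i := by
    intro μ
    have := congrFun (congrFun (h2 μ) μ) i
    simpa [Matrix.mul_apply, Finset.sum_mul] using this
  simp only [pd_mul (cd_diff hd x) (cd_diff (hA _ i) x), h1, h2']
  rw [Finset.sum_add_distrib]
  have e1 : ∑ μ, d * (∑ b, ∑ a, S μ b a * A a b) * A μ i =
      d * ∑ μ, ∑ b, ∑ a, S μ b a * A a b * A μ i := by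
    simp only [Finset.mul_sum, Finset.sum_mul, mul_assoc]
  have e2 : ∑ μ, d * (- ∑ c, ∑ b, A μ b * S μ b c * A c i) =
      - (d * ∑ μ, ∑ c, ∑ b, A μ b * S μ b c * A c i) := by
    simp only [Finset.mul_sum, mul_neg, Finset.sum_neg_distrib]
  have e3 : ∑ μ, ∑ b, ∑ a, S μ b a * A a b * A μ i =
      ∑ μ, ∑ c, ∑ b, A μ b * S μ b c * A c i := by
    rw [Finset.sum_comm (f := fun μ c => ∑ b, A μ b * S μ b c * A c i)]
    refine Finset.sum_congr rfl fun μ _ => ?_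
    rw [Finset.sum_comm]
    refine Finset.sum_congr rfl fun a _ => ?_
    refine Finset.sum_congr rfl fun b _ => ?_
    rw [hsym μ b a]; ring
  change ∑ μ, d * (∑ b, ∑ a, S μ b a * A a b) * A μ i +
    ∑ μ, d * (- ∑ c, ∑ b, A μ b * S μ b c * A c i) = 0
  rw [e1, e2, e3]; ring

theorem contDiff_flux {g : (Fin n → ℝ) → Matrix (Fin n) (Fin n) ℝ}
    (hg : ∀ i j, ContDiff ℝ (⊤ : ℕ∞) fun x => g x i j) (hpos : ∀ x, 0 < (g x).det)
    {ψ : (Fin n → ℝ) → ℝ} (hψ : ContDiff ℝ (⊤ : ℕ∞) ψ) (i : Fin n) :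
    ContDiff ℝ (⊤ : ℕ∞) fun y => Real.sqrt (g y).det * ∑ ν, (g y)⁻¹ i ν * pd n ν ψ y := by
  refine ((contDiff_det hg).sqrt fun x => (hpos x).ne').mul ?_
  exact ContDiff.sum fun ν _ => (contDiff_inv hg (fun x => (hpos x).ne') i ν).mul (contDiff_pd hψ ν)

theorem det_pullback (f : (Fin n → ℝ) → (Fin n → ℝ))
    (g : (Fin n → ℝ) → Matrix (Fin n) (Fin n) ℝ) (x : Fin n → ℝ) :
    (pullbackMet n f g x).det = (jacobian n f x).det ^ 2 * (g (f x)).det := by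
  simp [pullbackMet, Matrix.det_mul, Matrix.det_transpose]; ring

theorem naturality {g : (Fin n → ℝ) → Matrix (Fin n) (Fin n) ℝ}
    (hg : ∀ i j, ContDiff ℝ (⊤ : ℕ∞) fun x => g x i j) (hpos : ∀ x, 0 < (g x).det)
    {ψ : (Fin n → ℝ) → ℝ} (hψ : ContDiff ℝ (⊤ : ℕ∞) ψ)
    {f : (Fin n → ℝ) → (Fin n → ℝ)} (hf : ContDiff ℝ (⊤ : ℕ∞) f)
    (h0 : ∀ x, (jacobian n f x).det ≠ 0) (x : Fin n → ℝ) :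
    lapBel n (pullbackMet n f g) (fun y => ψ (f y)) x = lapBel n g ψ (f x) := by
  have hJ := contDiff_jac hf
  have hA := contDiff_inv hJ h0
  have hd := contDiff_det hJ
  set W : Fin n → (Fin n → ℝ) → ℝ :=
    fun i y => Real.sqrt (g y).det * ∑ ν, (g y)⁻¹ i ν * pd n ν ψ y with hW
  have hWc : ∀ i, ContDiff ℝ (⊤ : ℕ∞) (W i) := fun i => contDiff_flux hg hpos hψ i
  set C : Fin n → Fin n → (Fin n → ℝ) → ℝ :=
    fun μ i y => (jacobian n f y).det * (jacobian n f y)⁻¹ μ i with hC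
  have hCc : ∀ μ i, ContDiff ℝ (⊤ : ℕ∞) (C μ i) := fun μ i => hd.mul (hA μ i)
  have hsq : ∀ y, Real.sqrt (pullbackMet n f g y).det =
      |(jacobian n f y).det| * Real.sqrt (g (f y)).det := by
    intro y
    rw [det_pullback, Real.sqrt_mul (sq_nonneg _), Real.sqrt_sq_eq_abs]
  -- pointwise algebra
  have hflux : ∀ μ y, Real.sqrt (pullbackMet n f g y).det *
      ∑ ν, (pullbackMet n f g y)⁻¹ μ ν * pd n ν (fun y => ψ (f y)) y =
      |(jacobian n f y).det| * ∑ i, (jacobian n f y)⁻¹ μ i * W i (f y) := by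
    intro μ y
    have hv : (pullbackMet n f g y)⁻¹ *ᵥ (fun ν => pd n ν (fun y => ψ (f y)) y) =
        (jacobian n f y)⁻¹ *ᵥ ((g (f y))⁻¹ *ᵥ (fun k => pd n k ψ (f y))) := by
      have : (fun ν => pd n ν (fun y => ψ (f y)) y) =
          (jacobian n f y)ᵀ *ᵥ (fun k => pd n k ψ (f y)) := by
        ext ν
        rw [pd_comp (cd_diff hψ _) (cd_diff hf _)]
        simp [Matrix.mulVec, dotProduct, mul_comm]
      rw [this, pullbackMet, Matrix.mul_inv_rev, Matrix.mul_inv_rev, Matrix.mulVec_mulVec,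
        Matrix.mulVec_mulVec]
      congr 1
      rw [Matrix.mul_assoc, Matrix.mul_assoc, Matrix.nonsing_inv_mul, Matrix.mul_one]
      rw [Matrix.det_transpose]
      exact (h0 y).isUnit
    have hv' := congrFun hv μ
    simp only [Matrix.mulVec, dotProduct] at hv'
    rw [hv', hsq, mul_assoc, Finset.mul_sum]
    congr 1
    refine Finset.sum_congr rfl fun i _ => ?_
    simp only [hW]; ring
  -- sign
  obtain ⟨s, hs, hs0⟩ : ∃ s : ℝ, (∀ᶠ y in nhds x, |(jacobian n f y).det| =
      s * (jacobian n f y).det) ∧ True := by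
    rcases lt_or_gt_of_ne (h0 x) with h | h
    · refine ⟨-1, ?_, trivial⟩
      filter_upwards [hd.continuous.continuousAt.eventually_lt_const h] with y hy
      rw [abs_of_neg hy]; ring
    · refine ⟨1, ?_, trivial⟩
      filter_upwards [hd.continuous.continuousAt.eventually_const_lt h] with y hy
      rw [abs_of_pos hy]; ring
  have hdiv : ∀ μ, pd n μ (fun y => Real.sqrt (pullbackMet n f g y).det *
      ∑ ν, (pullbackMet n f g y)⁻¹ μ ν * pd n ν (fun y => ψ (f y)) y) x =
      s * ∑ i, (pd n μ (C μ i) x * W i (f x) +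
        C μ i x * ∑ k, pd n k (W i) (f x) * jacobian n f x k μ) := by
    intro μ
    have hWf : ∀ i, ContDiff ℝ (⊤ : ℕ∞) (fun y => W i (f y)) := fun i => (hWc i).comp hf
    have : (fun y => Real.sqrt (pullbackMet n f g y).det *
      ∑ ν, (pullbackMet n f g y)⁻¹ μ ν * pd n ν (fun y => ψ (f y)) y) =ᶠ[nhds x]
      fun y => s * ∑ i, C μ i y * W i (f y) := by
      filter_upwards [hs] with y hy
      rw [hflux, hy, mul_assoc, Finset.mul_sum]
      simp only [hC, mul_assoc]
    rw [pd_congr this, pd_mul (by fun_prop)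
      (cd_diff (ContDiff.sum fun i _ => (hCc μ i).mul (hWf i)) x),
      pd_sum (a := fun i y => C μ i y * W i (f y)) (fun i => (cd_diff (hCc μ i) x).mul (cd_diff (hWf i) x))]
    have hc : pd n μ (fun _ => s) x = 0 := by simp [pd]
    rw [hc, zero_mul, zero_add]
    congr 1
    refine Finset.sum_congr rfl fun i _ => ?_
    rw [pd_mul (cd_diff (hCc μ i) x) (cd_diff (hWf i) x),
      pd_comp (cd_diff (hWc i) _) (cd_diff hf x)]
  have hsx : |(jacobian n f x).det| = s * (jacobian n f x).det := hs.self_of_nhds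
  unfold lapBel
  rw [hsq]
  simp only [hdiv]
  rw [← Finset.mul_sum, Finset.sum_comm]
  have hi : ∀ i, ∑ μ, (pd n μ (C μ i) x * W i (f x) +
        C μ i x * ∑ k, pd n k (W i) (f x) * jacobian n f x k μ) =
        (jacobian n f x).det * pd n i (W i) (f x) := by
    intro i
    rw [Finset.sum_add_distrib, ← Finset.sum_mul, piola hf h0 x i, zero_mul, zero_add]
    simp only [Finset.mul_sum]
    rw [Finset.sum_comm]
    have hk : ∀ k, ∑ μ, C μ i x * (pd n k (W i) (f x) * jacobian n f x k μ) =
        (jacobian n f x).det * pd n k (W i) (f x) * (1 : Matrix (Fin n) (Fin n) ℝ) k i := by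
      intro k
      rw [← Matrix.mul_nonsing_inv (jacobian n f x) (h0 x).isUnit, Matrix.mul_apply,
        Finset.mul_sum]
      refine Finset.sum_congr rfl fun μ _ => ?_
      simp only [hC]; ring
    simp only [hk, Matrix.one_apply]
    simp
  simp only [hi]
  rw [← Finset.mul_sum, mul_inv, hsx]
  have : s * (jacobian n f x).det ≠ 0 := by rw [← hsx]; exact abs_ne_zero.2 (h0 x)
  have h5 := inv_mul_cancel₀ this
  calc _ = ((s * (jacobian n f x).det)⁻¹ * (s * (jacobian n f x).det)) *
      ((Real.sqrt (g (f x)).det)⁻¹ * ∑ i, pd n i (W i) (f x)) := by ring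
    _ = _ := by rw [h5, one_mul]

theorem contDiff_pd_param {P : Type*} [NormedAddCommGroup P] [NormedSpace ℝ P]
    {u : P → (Fin n → ℝ) → ℝ} (hu : ContDiff ℝ (⊤ : ℕ∞) (Function.uncurry u)) (μ : Fin n) :
    ContDiff ℝ (⊤ : ℕ∞) (fun q : P × (Fin n → ℝ) => pd n μ (u q.1) q.2) := by
  unfold pd
  have : ContDiff ℝ (⊤ : ℕ∞) (fun q : P × (Fin n → ℝ) => fderiv ℝ (u q.1) q.2) := by
    refine ContDiff.fderiv (f := fun (q : P × (Fin n → ℝ)) => u q.1) (g := fun q => q.2)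
      (n := (⊤ : ℕ∞)) (m := (⊤ : ℕ∞)) ?_ contDiff_snd (by simp)
    exact hu.comp (f := fun z : (P × (Fin n → ℝ)) × (Fin n → ℝ) => (z.1.1, z.2)) (by fun_prop)
  exact this.clm_apply contDiff_const

theorem contDiff_lapBel_param {P : Type*} [NormedAddCommGroup P] [NormedSpace ℝ P]
    {G : P → (Fin n → ℝ) → Matrix (Fin n) (Fin n) ℝ}
    (hG : ∀ i j, ContDiff ℝ (⊤ : ℕ∞) (fun q : P × (Fin n → ℝ) => G q.1 q.2 i j))
    (hpos : ∀ p x, 0 < (G p x).det)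
    {u : P → (Fin n → ℝ) → ℝ} (hu : ContDiff ℝ (⊤ : ℕ∞) (Function.uncurry u)) :
    ContDiff ℝ (⊤ : ℕ∞) (fun q : P × (Fin n → ℝ) => lapBel n (G q.1) (u q.1) q.2) := by
  have hsq : ContDiff ℝ (⊤ : ℕ∞) (fun q : P × (Fin n → ℝ) => Real.sqrt (G q.1 q.2).det) :=
    (contDiff_det (M := fun q : P × (Fin n → ℝ) => G q.1 q.2) hG).sqrt fun q => (hpos _ _).ne'
  have hinv := contDiff_inv (M := fun q : P × (Fin n → ℝ) => G q.1 q.2) hG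
    fun q => (hpos _ _).ne'
  unfold lapBel
  refine (hsq.inv fun q => (Real.sqrt_pos.2 (hpos _ _)).ne').mul (ContDiff.sum fun μ _ => ?_)
  refine contDiff_pd_param (u := fun p y => Real.sqrt (G p y).det *
    ∑ ν, (G p y)⁻¹ μ ν * pd n ν (u p) y) ?_ μ
  exact hsq.mul (ContDiff.sum fun ν _ => (hinv μ ν).mul (contDiff_pd_param hu ν))

theorem swap {u : ℝ → (Fin n → ℝ) → ℝ} (hu : ContDiff ℝ (⊤ : ℕ∞) (Function.uncurry u))
    {D : (Fin n → ℝ) → ℝ} (hD : ∀ y, HasDerivAt (fun s => u s y) (D y) 0) (μ : Fin n)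
    (x : Fin n → ℝ) : HasDerivAt (fun s => pd n μ (u s) x) (pd n μ D x) 0 := by
  set U := Function.uncurry u with hU
  have h1 : ContDiff ℝ (⊤ : ℕ∞) (fderiv ℝ U) := hu.fderiv_right (by simp)
  have hs : IsSymmSndFDerivAt ℝ U (0, x) :=
    hu.contDiffAt.isSymmSndFDerivAt (by simpa using two_le_inf)
  have hl : ∀ s y, HasFDerivAt (fun y : Fin n → ℝ => ((s : ℝ), y))
      (ContinuousLinearMap.inr ℝ ℝ (Fin n → ℝ)) y := fun s y => hasFDerivAt_prodMk_right s y
  have hr : ∀ s y, HasDerivAt (fun s : ℝ => (s, (y : Fin n → ℝ))) ((1 : ℝ), (0 : Fin n → ℝ)) s :=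
    fun s y => (hasDerivAt_id s).prodMk (hasDerivAt_const s y)
  have e1 : (fun s => pd n μ (u s) x) = fun s => fderiv ℝ U (s, x) (0, Pi.single μ 1) := by
    ext s
    have := ((cd_diff hu (s, x)).hasFDerivAt.comp x (hl s x)).fderiv
    unfold pd
    change fderiv ℝ (U ∘ (fun y => (s, y))) x _ = _
    rw [this]; simp
  have e2 : D = fun y => fderiv ℝ U (0, y) (1, 0) := by
    ext y
    have := (cd_diff hu ((0 : ℝ), y)).hasFDerivAt.comp_hasDerivAt (0 : ℝ) (hr 0 y)
    exact (hD y).unique this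
  have d1 : HasDerivAt (fun s => fderiv ℝ U (s, x)) (fderiv ℝ (fderiv ℝ U) (0, x) (1, 0)) 0 :=
    (cd_diff h1 ((0 : ℝ), x)).hasFDerivAt.comp_hasDerivAt (0 : ℝ) (hr 0 x)
  have d2 : HasFDerivAt (fun y => fderiv ℝ U ((0 : ℝ), y)) _ x :=
    (cd_diff h1 ((0 : ℝ), x)).hasFDerivAt.comp x (hl 0 x)
  have d3 : pd n μ D x = fderiv ℝ (fderiv ℝ U) (0, x) (1, 0) (0, Pi.single μ 1) := by
    rw [e2, pd, fderiv_clm_apply d2.differentiableAt (by fun_prop), d2.fderiv]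
    simp
    exact hs _ _
  rw [e1, d3]
  simpa using d1.clm_apply (hasDerivAt_const (0 : ℝ) ((0 : ℝ), (Pi.single μ 1 : Fin n → ℝ)))

theorem det_jac_ne {f h : (Fin n → ℝ) → (Fin n → ℝ)} (hf : ContDiff ℝ (⊤ : ℕ∞) f)
    (hh : ContDiff ℝ (⊤ : ℕ∞) h) (hl : Function.LeftInverse h f) (x : Fin n → ℝ) :
    (jacobian n f x).det ≠ 0 := by
  have : jacobian n h (f x) * jacobian n f x = 1 := by
    ext i j
    rw [Matrix.mul_apply]
    have h1 : (fun y => h (f y) i) = fun y => y i := by ext y; rw [hl y]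
    have h2 := pd_comp (μ := j) (w := fun z => h z i) (f := f) (x := x)
      (cd_diff (contDiff_pi.1 hh i) _) (cd_diff hf x)
    rw [h1] at h2
    simp only [jac_eq_pd (cd_diff hh (f x))]
    rw [← h2]
    unfold pd
    rw [fderiv_apply (by fun_prop)]
    simp [Pi.single_apply, Matrix.one_apply]
  intro h0
  have := congrArg Matrix.det this
  simp [Matrix.det_mul, h0] at this

end Helpers

/-- The first-order deformation of the Laplace–Beltrami operator along the diffeomorphism
orbit of `g` is the commutator `[L_V, Δ_g]`: if `f_t = F(t,·)` is a smooth family of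
diffeomorphisms with `f_0 = id` generated at `t = 0` by the vector field `V`, then
`d/dt Δ_{f_t*g}φ(x) |_{t=0} = L_V(Δ_g φ)(x) − Δ_g(L_V φ)(x)`. -/
theorem laplace_beltrami_deformation_along_orbit (n : ℕ)
    (g : (Fin n → ℝ) → Matrix (Fin n) (Fin n) ℝ)
    (hg : ∀ i j, ContDiff ℝ (⊤ : ℕ∞) fun x => g x i j)
    (hsymm : ∀ x, (g x).IsSymm) (hpos : ∀ x, (g x).PosDef)
    (φ : (Fin n → ℝ) → ℝ) (hφ : ContDiff ℝ (⊤ : ℕ∞) φ)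
    (F : ℝ × (Fin n → ℝ) → (Fin n → ℝ)) (hF : ContDiff ℝ (⊤ : ℕ∞) F)
    (hF0 : ∀ x, F (0, x) = x)
    (hdiffeo : ∀ t, ∃ finv : (Fin n → ℝ) → (Fin n → ℝ), ContDiff ℝ (⊤ : ℕ∞) finv ∧
      Function.LeftInverse finv (fun x => F (t, x)) ∧
      Function.RightInverse finv (fun x => F (t, x)))
    (V : (Fin n → ℝ) → (Fin n → ℝ))
    (hV : ∀ x, HasDerivAt (fun t => F (t, x)) (V x) 0) (x : Fin n → ℝ) :
    HasDerivAt (fun t => lapBel n (pullbackMet n (fun y => F (t, y)) g) φ x)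
      (fderiv ℝ (lapBel n g φ) x (V x) -
        lapBel n g (fun y => fderiv ℝ φ y (V y)) x) 0 := by
  have hdet : ∀ x, 0 < (g x).det := fun x => (hpos x).det_pos
  have hFs : ∀ t, ContDiff ℝ (⊤ : ℕ∞) (fun y => F (t, y)) := fun t =>
    hF.comp (contDiff_prodMk_right t)
  have hJ0 : ∀ t y, (jacobian n (fun y => F (t, y)) y).det ≠ 0 := by
    intro t y
    obtain ⟨h, hh, hl, -⟩ := hdiffeo t
    exact det_jac_ne (hFs t) hh hl y
  -- joint smoothness of the Jacobian and of the pullback metric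
  have hJc : ∀ i j, ContDiff ℝ (⊤ : ℕ∞) (fun q : ℝ × (Fin n → ℝ) =>
      jacobian n (fun y => F (q.1, y)) q.2 i j) := by
    intro i j
    have e : (fun q : ℝ × (Fin n → ℝ) => jacobian n (fun y => F (q.1, y)) q.2 i j) =
        fun q => pd n j ((fun t y => F (t, y) i) q.1) q.2 := by
      ext q
      exact jac_eq_pd (cd_diff (hFs q.1) _) i j
    rw [e]
    exact contDiff_pd_param (u := fun t y => F (t, y) i) (contDiff_pi.1 hF i) j
  have hGc : ∀ i j, ContDiff ℝ (⊤ : ℕ∞) (fun q : ℝ × (Fin n → ℝ) =>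
      pullbackMet n (fun y => F (q.1, y)) g q.2 i j) := by
    intro i j
    simp only [pullbackMet, Matrix.mul_apply, Matrix.transpose_apply]
    refine ContDiff.sum fun a _ => ContDiff.mul (ContDiff.sum fun b _ => ?_) (hJc _ _)
    exact (hJc _ _).mul ((hg _ _).comp hF)
  have hGpos : ∀ t y, 0 < (pullbackMet n (fun y => F (t, y)) g y).det := by
    intro t y
    rw [det_pullback]
    have := hJ0 t y
    have := hdet (F (t, y))
    positivity
  have huc : ContDiff ℝ (⊤ : ℕ∞) (Function.uncurry fun (s : ℝ) (y : Fin n → ℝ) => φ (F (s, y))) :=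
    hφ.comp hF
  have hH := contDiff_lapBel_param (P := ℝ × ℝ)
    (G := fun p => pullbackMet n (fun y => F (p.1, y)) g) (u := fun p y => φ (F (p.2, y)))
    (fun i j => (hGc i j).comp
      (f := fun q : (ℝ × ℝ) × (Fin n → ℝ) => (q.1.1, q.2)) (by fun_prop))
    (fun p y => hGpos p.1 y)
    (huc.comp (f := fun q : (ℝ × ℝ) × (Fin n → ℝ) => (q.1.2, q.2)) (by fun_prop))
  have hH' : ContDiff ℝ (⊤ : ℕ∞) (fun p : ℝ × ℝ =>
      lapBel n (pullbackMet n (fun y => F (p.1, y)) g) (fun y => φ (F (p.2, y))) x) :=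
    hH.comp (f := fun p : ℝ × ℝ => (p, x)) (by fun_prop)
  have hL := (cd_diff hH' (0, 0)).hasFDerivAt
  set L := fderiv ℝ (fun p : ℝ × ℝ =>
      lapBel n (pullbackMet n (fun y => F (p.1, y)) g) (fun y => φ (F (p.2, y))) x) (0, 0)
  have hG0 : pullbackMet n (fun y => F (0, y)) g = g := by
    have e : (fun y => F (0, y)) = fun y => y := funext hF0
    have hj : ∀ y, jacobian n (fun y => y) y = 1 := by
      intro y
      ext i j
      simp [jacobian, Matrix.one_apply, Pi.single_apply]
    ext y i j
    simp [pullbackMet, e, hj, hF0]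
  -- three directional derivatives
  have hA : HasDerivAt (fun t => lapBel n (pullbackMet n (fun y => F (t, y)) g) φ x)
      (L (1, 0)) 0 := by
    have := hL.comp_hasDerivAt (0 : ℝ) (f := fun t : ℝ => (t, (0 : ℝ)))
      ((hasDerivAt_id (0 : ℝ)).prodMk (hasDerivAt_const (0 : ℝ) (0 : ℝ)))
    simpa [Function.comp_def, hF0] using this
  have hB : HasDerivAt (fun s => lapBel n g (fun y => φ (F (s, y))) x) (L (0, 1)) 0 := by
    have := hL.comp_hasDerivAt (0 : ℝ) (f := fun t : ℝ => ((0 : ℝ), t))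
      ((hasDerivAt_const (0 : ℝ) (0 : ℝ)).prodMk (hasDerivAt_id (0 : ℝ)))
    simpa only [Function.comp_def, hG0] using this
  have hC : HasDerivAt (fun t => lapBel n g φ (F (t, x))) (L (1, 1)) 0 := by
    have := hL.comp_hasDerivAt (0 : ℝ) (f := fun t : ℝ => (t, t))
      ((hasDerivAt_id (0 : ℝ)).prodMk (hasDerivAt_id (0 : ℝ)))
    refine this.congr_of_eventuallyEq (Filter.Eventually.of_forall fun t => ?_)
    exact (naturality hg hdet hφ (hFs t) (hJ0 t) x).symm
  -- identify the second and third
  have hlap : ContDiff ℝ (⊤ : ℕ∞) (lapBel n g φ) := by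
    have := contDiff_lapBel_param (P := ℝ) (G := fun _ => g) (u := fun _ => φ)
      (fun i j => (hg i j).comp contDiff_snd) (fun _ y => hdet y) (hφ.comp contDiff_snd)
    exact this.comp (f := fun y : Fin n → ℝ => ((0 : ℝ), y)) (by fun_prop)
  have hC' : HasDerivAt (fun t => lapBel n g φ (F (t, x))) (fderiv ℝ (lapBel n g φ) x (V x)) 0 := by
    have h1 : HasFDerivAt (lapBel n g φ) (fderiv ℝ (lapBel n g φ) x) (F (0, x)) := by
      rw [hF0]; exact (cd_diff hlap x).hasFDerivAt
    exact h1.comp_hasDerivAt (0 : ℝ) (hV x)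
  have hu0 : ∀ y, HasDerivAt (fun s => φ (F (s, y))) (fderiv ℝ φ y (V y)) 0 := by
    intro y
    have h1 : HasFDerivAt φ (fderiv ℝ φ y) (F (0, y)) := by
      rw [hF0]; exact (cd_diff hφ y).hasFDerivAt
    exact h1.comp_hasDerivAt (0 : ℝ) (hV y)
  have hB' : HasDerivAt (fun s => lapBel n g (fun y => φ (F (s, y))) x)
      (lapBel n g (fun y => fderiv ℝ φ y (V y)) x) 0 := by
    unfold lapBel
    refine HasDerivAt.const_mul _ (HasDerivAt.fun_sum fun μ _ => ?_)
    refine swap (u := fun s y => Real.sqrt (g y).det *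
      ∑ ν, (g y)⁻¹ μ ν * pd n ν (fun y => φ (F (s, y))) y) ?_ ?_ μ x
    · refine (((contDiff_det hg).sqrt fun x => (hdet x).ne').comp contDiff_snd).mul
        (ContDiff.sum fun ν _ => ?_)
      exact ((contDiff_inv hg (fun x => (hdet x).ne') μ ν).comp contDiff_snd).mul
        (contDiff_pd_param huc ν)
    · intro y
      refine HasDerivAt.const_mul _ (HasDerivAt.fun_sum fun ν _ => HasDerivAt.const_mul _ ?_)
      exact swap huc hu0 ν y
  have e1 := hC.unique hC'
  have e2 := hB.unique hB'
  have e3 : L (1, 0) = L (1, 1) - L (0, 1) := by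
    rw [← map_sub]; simp
  rw [← e1, ← e2, ← e3]
  exact hA
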